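/- Let G be a group and let X be a closed linear subspace of the Banach space B(ℓ²(G)) of bounded linear operators on ℓ²(G) such that λ(s) ∈ X for every s ∈ G. For T ∈ B(ℓ²(G)) and s ∈ G set δ_s·T := ((T δ_e)(s)) • λ(s), where δ_e = lp.single 2 e 1 and (T δ_e)(s) is the s-th coordinate of T δ_e ∈ ℓ²(G); note δ_s·T ∈ X. Suppose there exists a bounded linear map ρ : X → ℓ¹(G; X) such that: (i) for every T ∈ X, the family (δ_s·((ρ T)(s)))_{s ∈ G} is summable in operator norm with sum equal to T; and (ii) for all s ∈ G and T ∈ X, (ρ(δ_s·T))(t) = (ρ T)(s) if t = s and (ρ(δ_s·T))(t) = 0 if t ≠ s. Then G is finite. -/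

import Mathlib

open ENNReal

set_option synthInstance.maxHeartbeats 1000000

theorem aux_lam_norm {G : Type*} [Group G]
    (lam : G → (lp (fun _ : G => ℂ) 2 →L[ℂ] lp (fun _ : G => ℂ) 2))
    (hlam : ∀ (s : G) (u : lp (fun _ : G => ℂ) 2) (x : G), lam s u x = u (s⁻¹ * x))
    (s : G) (u : lp (fun _ : G => ℂ) 2) : ‖lam s u‖ = ‖u‖ := by
  rw [lp.norm_eq_tsum_rpow (by norm_num), lp.norm_eq_tsum_rpow (by norm_num)]
  congr 1
  simp_rw [hlam]
  exact (Equiv.mulLeft s⁻¹).tsum_eq (fun x => ‖u x‖ ^ (2 : ℝ≥0∞).toReal)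

theorem aux_lam_mul {G : Type*} [Group G]
    (lam : G → (lp (fun _ : G => ℂ) 2 →L[ℂ] lp (fun _ : G => ℂ) 2))
    (hlam : ∀ (s : G) (u : lp (fun _ : G => ℂ) 2) (x : G), lam s u x = u (s⁻¹ * x))
    (g s : G) : (lam g).comp (lam s) = lam (g * s) := by
  ext u x
  simp [hlam, mul_assoc]

theorem aux_lam_span {G : Type*} [Group G]
    (lam : G → (lp (fun _ : G => ℂ) 2 →L[ℂ] lp (fun _ : G => ℂ) 2))
    (hlam : ∀ (s : G) (u : lp (fun _ : G => ℂ) 2) (x : G), lam s u x = u (s⁻¹ * x))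
    (g : G) (T : lp (fun _ : G => ℂ) 2 →L[ℂ] lp (fun _ : G => ℂ) 2)
    (hT : T ∈ Submodule.span ℂ (Set.range lam)) :
    (lam g).comp T ∈ Submodule.span ℂ (Set.range lam) := by
  induction hT using Submodule.span_induction with
  | mem x hx =>
    obtain ⟨s, rfl⟩ := hx
    rw [aux_lam_mul lam hlam]
    exact Submodule.subset_span ⟨_, rfl⟩
  | zero => simp
  | add x y _ _ hx hy => rw [ContinuousLinearMap.comp_add]; exact Submodule.add_mem _ hx hy
  | smul a x _ hx => rw [ContinuousLinearMap.comp_smul]; exact Submodule.smul_mem _ _ hx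

theorem aux_single {G : Type*} [Group G] [DecidableEq G]
    (lam : G → (lp (fun _ : G => ℂ) 2 →L[ℂ] lp (fun _ : G => ℂ) 2))
    (hlam : ∀ (s : G) (u : lp (fun _ : G => ℂ) 2) (x : G), lam s u x = u (s⁻¹ * x))
    (s t : G) : lam s (lp.single 2 (1 : G) (1 : ℂ)) t = if t = s then 1 else 0 := by
  rw [hlam, lp.single_apply]
  by_cases h : t = s
  · subst h; simp
  · have h2 : s⁻¹ * t ≠ 1 := by
      intro h3; exact h (inv_mul_eq_one.mp h3).symm
    simp [h, h2]

theorem aux_coord {G : Type*} [DecidableEq G] [One G]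
    (f : G → (lp (fun _ : G => ℂ) 2 →L[ℂ] lp (fun _ : G => ℂ) 2))
    (T : lp (fun _ : G => ℂ) 2 →L[ℂ] lp (fun _ : G => ℂ) 2) (h : HasSum f T) (s : G) :
    HasSum (fun t => f t (lp.single 2 (1 : G) (1 : ℂ)) s) (T (lp.single 2 (1 : G) (1 : ℂ)) s) := by
  have h1 := h.mapL (ContinuousLinearMap.apply ℂ (lp (fun _ : G => ℂ) 2)
    (lp.single 2 (1 : G) (1 : ℂ) : lp (fun _ : G => ℂ) 2))
  simp only [ContinuousLinearMap.apply_apply] at h1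
  exact h1.mapL (lp.evalCLM ℂ (fun _ : G => ℂ) 2 s)

theorem aux_coord_norm {G : Type*} [DecidableEq G] [One G]
    (R : lp (fun _ : G => ℂ) 2 →L[ℂ] lp (fun _ : G => ℂ) 2) (s : G) :
    ‖R (lp.single 2 (1 : G) (1 : ℂ)) s‖ ≤ ‖R‖ := by
  have h1 := lp.norm_apply_le_norm (by norm_num) (R (lp.single 2 (1 : G) (1 : ℂ))) s
  have h2 := R.le_opNorm (lp.single 2 (1 : G) (1 : ℂ))
  have h3 : ‖(lp.single 2 (1 : G) (1 : ℂ) : lp (fun _ : G => ℂ) 2)‖ = 1 := by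
    rw [lp.norm_single (by norm_num)]; simp
  rw [h3, mul_one] at h2
  exact h1.trans h2

theorem aux_l1 {G : Type*} {E : Type*} [NormedAddCommGroup E]
    (f : lp (fun _ : G => E) 1) (S : Finset G) : ∑ s ∈ S, ‖f s‖ ≤ ‖f‖ := by
  simpa using lp.sum_rpow_le_norm_rpow (by norm_num) f S

theorem aux_l1_bound {G : Type*} {E : Type*} [NormedAddCommGroup E] [NormedSpace ℂ E]
    (ρ : E →L[ℂ] lp (fun _ : G => E) 1) :
    ∃ C : ℝ, 0 ≤ C ∧ ∀ (T : E) (S : Finset G), ∑ s ∈ S, ‖ρ T s‖ ≤ C * ‖T‖ :=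
  ⟨‖ρ‖, norm_nonneg _, fun T S => (aux_l1 (ρ T) S).trans (ρ.le_opNorm T)⟩

/-- Rudin-Shapiro pairs over an infinite group. -/
theorem aux_rudin_shapiro {G : Type*} [Group G] [DecidableEq G] [Infinite G]
    (lam : G → (lp (fun _ : G => ℂ) 2 →L[ℂ] lp (fun _ : G => ℂ) 2))
    (hlam : ∀ (s : G) (u : lp (fun _ : G => ℂ) 2) (x : G), lam s u x = u (s⁻¹ * x))
    (n : ℕ) : ∃ (S : Finset G) (P Q : lp (fun _ : G => ℂ) 2 →L[ℂ] lp (fun _ : G => ℂ) 2),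
      S.card = 2 ^ n ∧ P ∈ Submodule.span ℂ (Set.range lam) ∧
      Q ∈ Submodule.span ℂ (Set.range lam) ∧
      (∀ x, ‖P (lp.single 2 (1 : G) (1 : ℂ)) x‖ = if x ∈ S then 1 else 0) ∧
      (∀ x, ‖Q (lp.single 2 (1 : G) (1 : ℂ)) x‖ = if x ∈ S then 1 else 0) ∧
      ∀ u, ‖P u‖ ^ 2 + ‖Q u‖ ^ 2 = 2 ^ (n + 1) * ‖u‖ ^ 2 := by
  induction n with
  | zero =>
    refine ⟨{1}, lam 1, lam 1, by simp, Submodule.subset_span ⟨_, rfl⟩,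
      Submodule.subset_span ⟨_, rfl⟩, ?_, ?_, ?_⟩
    · intro x; rw [aux_single lam hlam]; by_cases h : x = 1 <;> simp [h]
    · intro x; rw [aux_single lam hlam]; by_cases h : x = 1 <;> simp [h]
    · intro u; rw [aux_lam_norm lam hlam]; ring
  | succ n ih =>
    obtain ⟨S, P, Q, hS, hP, hQ, hPx, hQx, hu⟩ := ih
    obtain ⟨g, hg⟩ := Infinite.exists_notMem_finset
      ((S ×ˢ S).image (fun p : G × G => p.1 * p.2⁻¹))
    have hdis : ∀ x, x ∈ S → g⁻¹ * x ∈ S → False := by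
      intro x hx hx'
      apply hg
      rw [Finset.mem_image]
      exact ⟨(x, g⁻¹ * x), Finset.mk_mem_product hx hx', by simp⟩
    have hmem : ∀ x, x ∈ S.image (fun y => g * y) ↔ g⁻¹ * x ∈ S := by
      intro x
      rw [Finset.mem_image]
      constructor
      · rintro ⟨y, hy, rfl⟩; simpa using hy
      · intro h; exact ⟨_, h, by simp⟩
    have key : ∀ x, (x ∈ S ∧ g⁻¹ * x ∉ S) ∨ (x ∉ S ∧ g⁻¹ * x ∈ S) ∨
        (x ∉ S ∧ g⁻¹ * x ∉ S) := by
      intro x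
      have := hdis x
      tauto
    refine ⟨S ∪ S.image (fun y => g * y), P + (lam g).comp Q, P - (lam g).comp Q, ?_,
      Submodule.add_mem _ hP (aux_lam_span lam hlam g Q hQ),
      Submodule.sub_mem _ hP (aux_lam_span lam hlam g Q hQ), ?_, ?_, ?_⟩
    · rw [Finset.card_union_of_disjoint, Finset.card_image_of_injective _ (mul_right_injective g),
        hS]
      · ring
      · rw [Finset.disjoint_left]
        intro x hx hx'
        exact hdis x hx ((hmem x).1 hx')
    · intro x
      have h1 := hPx x
      have h2 := hQx (g⁻¹ * x)
      simp only [Finset.mem_union, hmem, _root_.add_apply,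
        ContinuousLinearMap.comp_apply, lp.coeFn_add, Pi.add_apply, hlam]
      rcases key x with ⟨a, b⟩ | ⟨a, b⟩ | ⟨a, b⟩
      · rw [if_pos a] at h1; rw [if_neg b, norm_eq_zero] at h2
        rw [h2, add_zero, h1, if_pos (Or.inl a)]
      · rw [if_neg a, norm_eq_zero] at h1; rw [if_pos b] at h2
        rw [h1, zero_add, h2, if_pos (Or.inr b)]
      · rw [if_neg a, norm_eq_zero] at h1; rw [if_neg b, norm_eq_zero] at h2
        rw [h1, h2, if_neg (by tauto)]; simp
    · intro x
      have h1 := hPx x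
      have h2 := hQx (g⁻¹ * x)
      simp only [Finset.mem_union, hmem, _root_.sub_apply,
        ContinuousLinearMap.comp_apply, lp.coeFn_sub, Pi.sub_apply, hlam]
      rcases key x with ⟨a, b⟩ | ⟨a, b⟩ | ⟨a, b⟩
      · rw [if_pos a] at h1; rw [if_neg b, norm_eq_zero] at h2
        rw [h2, sub_zero, h1, if_pos (Or.inl a)]
      · rw [if_neg a, norm_eq_zero] at h1; rw [if_pos b] at h2
        rw [h1, zero_sub, norm_neg, h2, if_pos (Or.inr b)]
      · rw [if_neg a, norm_eq_zero] at h1; rw [if_neg b, norm_eq_zero] at h2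
        rw [h1, h2, if_neg (by tauto)]; simp
    · intro u
      have h := parallelogram_law_with_norm ℂ (P u) (lam g (Q u))
      rw [aux_lam_norm lam hlam] at h
      have h3 := hu u
      simp only [_root_.add_apply, _root_.sub_apply,
        ContinuousLinearMap.comp_apply]
      rw [pow_succ 2 (n + 1)]
      linear_combination h + 2 * h3

set_option maxHeartbeats 4000000 in
theorem finite_of_submodule_of_vn_projective
    (G : Type*) [Group G] [DecidableEq G]
    (lam : G → (lp (fun _ : G => ℂ) 2 →L[ℂ] lp (fun _ : G => ℂ) 2))
    (hlam : ∀ (s : G) (u : lp (fun _ : G => ℂ) 2) (x : G), lam s u x = u (s⁻¹ * x))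
    (X : Submodule ℂ (lp (fun _ : G => ℂ) 2 →L[ℂ] lp (fun _ : G => ℂ) 2))
    (hXclosed : IsClosed (X : Set (lp (fun _ : G => ℂ) 2 →L[ℂ] lp (fun _ : G => ℂ) 2)))
    (hlamX : ∀ s : G, lam s ∈ X)
    (ρ : X →L[ℂ] lp (fun _ : G => X) 1)
    (hsum : ∀ T : X,
      HasSum (fun s : G => (((ρ T s : X) : lp (fun _ : G => ℂ) 2 →L[ℂ] lp (fun _ : G => ℂ) 2)
          (lp.single 2 (1 : G) (1 : ℂ)) s) • lam s)
        (T : lp (fun _ : G => ℂ) 2 →L[ℂ] lp (fun _ : G => ℂ) 2))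
    (hmod : ∀ (s : G) (T : X) (t : G),
      ρ (⟨((T : lp (fun _ : G => ℂ) 2 →L[ℂ] lp (fun _ : G => ℂ) 2)
            (lp.single 2 (1 : G) (1 : ℂ)) s) • lam s,
          X.smul_mem _ (hlamX s)⟩ : X) t = if t = s then ρ T s else 0) :
    Finite G := by
  by_contra hfin
  rw [not_finite_iff_infinite] at hfin
  have hcoef : ∀ (T : X) (s : G),
      (T : lp (fun _ : G => ℂ) 2 →L[ℂ] lp (fun _ : G => ℂ) 2) (lp.single 2 (1 : G) (1 : ℂ)) s
      = ((ρ T s : X) : lp (fun _ : G => ℂ) 2 →L[ℂ] lp (fun _ : G => ℂ) 2)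
          (lp.single 2 (1 : G) (1 : ℂ)) s := by
    intro T s
    have h1 := aux_coord _ _ (hsum T) s
    have h2 := h1.unique (hasSum_single s ?_)
    · rw [h2]
      change _ * (lam s (lp.single 2 (1 : G) (1 : ℂ)) s) = _
      rw [aux_single lam hlam, if_pos rfl, mul_one]
    · intro t ht
      change _ * (lam t (lp.single 2 (1 : G) (1 : ℂ)) s) = 0
      rw [aux_single lam hlam, if_neg ht.symm, mul_zero]
  have hnorm : ∀ (T : X) (s : G),
      ‖(T : lp (fun _ : G => ℂ) 2 →L[ℂ] lp (fun _ : G => ℂ) 2) (lp.single 2 (1 : G) (1 : ℂ)) s‖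
      ≤ ‖ρ T s‖ := by
    intro T s
    rw [hcoef]
    exact aux_coord_norm ((ρ T s : X) : lp (fun _ : G => ℂ) 2 →L[ℂ] lp (fun _ : G => ℂ) 2) s
  obtain ⟨C, hC, hbound⟩ := aux_l1_bound (E := X) ρ
  obtain ⟨n, hn⟩ := pow_unbounded_of_one_lt (2 * C ^ 2) (one_lt_two : (1 : ℝ) < 2)
  obtain ⟨S, P, Q, hS, hP, hQ, hPx, hQx, hu⟩ := aux_rudin_shapiro lam hlam n
  have hPX : P ∈ X := by
    refine (Submodule.span_le.2 ?_) hP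
    rintro _ ⟨s, rfl⟩
    exact hlamX s
  have hPn : ‖P‖ ≤ Real.sqrt (2 ^ (n + 1)) := by
    refine ContinuousLinearMap.opNorm_le_bound _ (Real.sqrt_nonneg _) ?_
    intro u
    refine (pow_le_pow_iff_left₀ (norm_nonneg _) (by positivity) two_ne_zero).1 ?_
    rw [mul_pow, Real.sq_sqrt (by positivity), ← hu u]
    nlinarith [sq_nonneg ‖Q u‖]
  have h1 : (2 : ℝ) ^ n ≤ C * ‖P‖ := by
    calc (2 : ℝ) ^ n = ∑ s ∈ S, ‖P (lp.single 2 (1 : G) (1 : ℂ)) s‖ := by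
          rw [Finset.sum_congr rfl (fun s hs => by rw [hPx s, if_pos hs])]
          simp [hS]
      _ ≤ ∑ s ∈ S, ‖ρ ⟨P, hPX⟩ s‖ := Finset.sum_le_sum (fun s _ => hnorm ⟨P, hPX⟩ s)
      _ ≤ _ := hbound ⟨P, hPX⟩ S
  have h2 : (2 : ℝ) ^ n ≤ C * Real.sqrt (2 ^ (n + 1)) :=
    h1.trans (mul_le_mul_of_nonneg_left hPn hC)
  have h3 := pow_le_pow_left₀ (by positivity) h2 2
  rw [mul_pow, Real.sq_sqrt (by positivity), pow_succ 2 n] at h3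
  have h4 : (0 : ℝ) < 2 ^ n := by positivity
  nlinarith
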